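/- arXiv:math/0304035 — 2 statements merged into one kernel-verified Lean document; each statement's English description precedes it below -/
import Mathlib

section
/- For all α, β ∈ F with αβ ≠ 0 and all a₁, a₂, a₂′ ∈ F, the bracket [L_{i,j},L_{k,ℓ}] = ((i+α)(ℓ−β)−(k+α)(j−β))L_{i+k,j+ℓ} + δ_{i+k,−α}δ_{j+ℓ,β}(αj+βi)a₁c₁ + δ_{i+k,−2α}δ_{j+ℓ,2β}(a₂(αj+βi)+a₂′(α+i))c₂, together with [c₁,−] = [c₂,−] = 0, makes B(α,β;a₁,a₂,a₂′) = B(α,β) ⊕ Fc₁ ⊕ Fc₂ a Lie algebra over F; equivalently, the two extra summands define a 2-cocycle on B(α,β), so B(α,β;a₁,a₂,a₂′) is a central extension of the Block algebra B(α,β). -/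
open Finsupp

/-- Bilinear extension of structure constants `c` to the free module with basis `ι`. -/
noncomputable def brkt {F : Type*} [Field F] {ι : Type*} (c : ι → ι → (ι →₀ F))
    (x y : ι →₀ F) : ι →₀ F :=
  Finsupp.sum x fun i a => Finsupp.sum y fun j b => (a * b) • c i j

/-- The index set `Z = ℤ×ℤ ∖ {(−α,β), (−2α,2β)}`. -/
def ZS {F : Type*} [Field F] (α β : F) : Set (ℤ × ℤ) :=
  {p | ¬((p.1 : F) = -α ∧ (p.2 : F) = β) ∧ ¬((p.1 : F) = -2 * α ∧ (p.2 : F) = 2 * β)}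

-- Structure constants of the Block algebra `B(α,β)`.
open Classical in
noncomputable def cB {F : Type*} [Field F] (α β : F) (p q : ↥(ZS α β)) :
    ↥(ZS α β) →₀ F :=
  if h : (p.1 + q.1 : ℤ × ℤ) ∈ ZS α β then
    Finsupp.single ⟨p.1 + q.1, h⟩
      (((p.1.1 : F) + α) * ((q.1.2 : F) - β) - ((q.1.1 : F) + α) * ((p.1.2 : F) - β))
  else 0

-- Structure constants of `B(α,β;a₁,a₂,a₂′) = B(α,β) ⊕ F c₁ ⊕ F c₂`, where `Sum.inr 0`
-- plays the role of `c₁` and `Sum.inr 1` the role of `c₂`, and `c₁, c₂` are central.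
open Classical in
noncomputable def cBE {F : Type*} [Field F] (α β a1 a2 a2' : F) :
    (↥(ZS α β) ⊕ Fin 2) → (↥(ZS α β) ⊕ Fin 2) → ((↥(ZS α β) ⊕ Fin 2) →₀ F)
  | Sum.inl p, Sum.inl q =>
      (if h : (p.1 + q.1 : ℤ × ℤ) ∈ ZS α β then
        Finsupp.single (Sum.inl ⟨p.1 + q.1, h⟩)
          (((p.1.1 : F) + α) * ((q.1.2 : F) - β) - ((q.1.1 : F) + α) * ((p.1.2 : F) - β))
      else 0)
      + Finsupp.single (Sum.inr 0)
          (if ((p.1.1 + q.1.1 : ℤ) : F) = -α ∧ ((p.1.2 + q.1.2 : ℤ) : F) = β then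
            (α * (p.1.2 : F) + β * (p.1.1 : F)) * a1
          else 0)
      + Finsupp.single (Sum.inr 1)
          (if ((p.1.1 + q.1.1 : ℤ) : F) = -2 * α ∧ ((p.1.2 + q.1.2 : ℤ) : F) = 2 * β then
            a2 * (α * (p.1.2 : F) + β * (p.1.1 : F)) + a2' * (α + (p.1.1 : F))
          else 0)
  | _, _ => 0

/-- The bracket `brkt c` as a bilinear map. -/
noncomputable def brktHom {F : Type*} [Field F] {ι : Type*} (c : ι → ι → (ι →₀ F)) :
    (ι →₀ F) →ₗ[F] (ι →₀ F) →ₗ[F] (ι →₀ F) :=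
  Finsupp.linearCombination F fun i => Finsupp.linearCombination F (c i)

theorem brkt_eq_brktHom {F : Type*} [Field F] {ι : Type*} (c : ι → ι → (ι →₀ F))
    (x y : ι →₀ F) : brkt c x y = brktHom c x y := by
  simp only [brkt, brktHom, Finsupp.linearCombination_apply, Finsupp.sum,
    LinearMap.sum_apply, LinearMap.smul_apply, Finset.smul_sum, smul_smul]

theorem brktHom_single {F : Type*} [Field F] {ι : Type*} (c : ι → ι → (ι →₀ F)) (i j : ι)
    (a b : F) : brktHom c (single i a) (single j b) = (a * b) • c i j := by
  simp [brktHom, Finsupp.linearCombination_single, smul_smul]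

theorem brkt_self_of_skew {F : Type*} [Field F] [CharZero F] {ι : Type*}
    {c : ι → ι → (ι →₀ F)} (hc : ∀ i j, c i j + c j i = 0) (x : ι →₀ F) :
    brkt c x x = 0 := by
  have h : brktHom c + (brktHom c).flip = 0 := by
    ext i j : 4
    simpa [brktHom_single] using hc i j
  have hx := LinearMap.congr_fun₂ h x x
  simp only [LinearMap.add_apply, LinearMap.flip_apply, LinearMap.zero_apply] at hx
  rw [← two_smul F, smul_eq_zero] at hx
  rw [brkt_eq_brktHom]
  exact hx.resolve_left two_ne_zero

theorem brkt_jacobi_of_basis {F : Type*} [Field F] {ι : Type*} {c : ι → ι → (ι →₀ F)}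
    (hc : ∀ i j k, brktHom c (single i 1) (c j k) + brktHom c (single j 1) (c k i) +
      brktHom c (single k 1) (c i j) = 0) (x y z : ι →₀ F) :
    brkt c x (brkt c y z) + brkt c y (brkt c z x) + brkt c z (brkt c x y) = 0 := by
  simp only [brkt_eq_brktHom]
  induction x using Finsupp.induction_linear with
  | zero => simp
  | add x x' hx hx' =>
    simp only [map_add, LinearMap.add_apply]
    rw [← add_zero (0 : ι →₀ F)]
    nth_rewrite 1 [← hx]
    rw [← hx']
    abel
  | single i a =>
  induction y using Finsupp.induction_linear with
  | zero => simp
  | add y y' hy hy' =>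
    simp only [map_add, LinearMap.add_apply]
    rw [← add_zero (0 : ι →₀ F)]
    nth_rewrite 1 [← hy]
    rw [← hy']
    abel
  | single j b =>
  induction z using Finsupp.induction_linear with
  | zero => simp
  | add z z' hz hz' =>
    simp only [map_add, LinearMap.add_apply]
    rw [← add_zero (0 : ι →₀ F)]
    nth_rewrite 1 [← hz]
    rw [← hz']
    abel
  | single k d =>
  have key := congrArg ((a * b * d) • ·) (hc i j k)
  have hs : ∀ (l : ι) (e : F), (single l e : ι →₀ F) = e • single l 1 := by simp
  simp only [brktHom_single]
  rw [hs i a, hs j b, hs k d]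
  simp only [map_smul, LinearMap.smul_apply, smul_smul, smul_add, smul_zero] at key ⊢
  rw [← key]
  congr 2
  · ring_nf
  · ring_nf

/-- The structure constant `(i+α)(ℓ−β) − (k+α)(j−β)` of the Block algebra. -/
def blockCoeff {F : Type*} [Field F] (α β : F) (p q : ℤ × ℤ) : F :=
  ((p.1 : F) + α) * ((q.2 : F) - β) - ((q.1 : F) + α) * ((p.2 : F) - β)

open Classical in
/-- The multiples of the basis vector `L_n`, with the convention `L_n = 0` for `n ∉ Z`. -/
noncomputable def blockVec {F : Type*} [Field F] (α β : F) (n : ℤ × ℤ) :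
    F →ₗ[F] ((↥(ZS α β) ⊕ Fin 2) →₀ F) :=
  if h : n ∈ ZS α β then Finsupp.lsingle (Sum.inl ⟨n, h⟩) else 0

open Classical in
/-- The coefficient of `c₁` in `[L_p, L_q]`, where `n = p + q`. -/
noncomputable def centralCoeffOne {F : Type*} [Field F] (α β a1 : F) (p n : ℤ × ℤ) : F :=
  if (n.1 : F) = -α ∧ (n.2 : F) = β then (α * (p.2 : F) + β * (p.1 : F)) * a1 else 0

open Classical in
/-- The coefficient of `c₂` in `[L_p, L_q]`, where `n = p + q`. -/
noncomputable def centralCoeffTwo {F : Type*} [Field F] (α β a2 a2' : F) (p n : ℤ × ℤ) : F :=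
  if (n.1 : F) = -2 * α ∧ (n.2 : F) = 2 * β then
    a2 * (α * (p.2 : F) + β * (p.1 : F)) + a2' * (α + (p.1 : F)) else 0

/-- The extended bracket `[L_p, L_q]`, given by the same formula for all `p, q ∈ ℤ × ℤ`. -/
noncomputable def extBracket {F : Type*} [Field F] (α β a1 a2 a2' : F) (p q : ℤ × ℤ) :
    (↥(ZS α β) ⊕ Fin 2) →₀ F :=
  blockVec α β (p + q) (blockCoeff α β p q)
    + single (Sum.inr 0) (centralCoeffOne α β a1 p (p + q))
    + single (Sum.inr 1) (centralCoeffTwo α β a2 a2' p (p + q))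

theorem cBE_inl_inl {F : Type*} [Field F] (α β a1 a2 a2' : F) (p q : ↥(ZS α β)) :
    cBE α β a1 a2 a2' (Sum.inl p) (Sum.inl q) = extBracket α β a1 a2 a2' p.1 q.1 := by
  by_cases h : p.1 + q.1 ∈ ZS α β
  · rw [extBracket, blockVec, dif_pos h]
    simp only [cBE]
    rw [dif_pos h]
    rfl
  · rw [extBracket, blockVec, dif_neg h]
    simp only [cBE]
    rw [dif_neg h]
    rfl

theorem cBE_inr_left {F : Type*} [Field F] (α β a1 a2 a2' : F) (t : Fin 2)
    (i : ↥(ZS α β) ⊕ Fin 2) : cBE α β a1 a2 a2' (Sum.inr t) i = 0 := rfl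

theorem cBE_inr_right {F : Type*} [Field F] (α β a1 a2 a2' : F) (t : Fin 2)
    (i : ↥(ZS α β) ⊕ Fin 2) : cBE α β a1 a2 a2' i (Sum.inr t) = 0 := by
  cases i <;> rfl

theorem brktHom_cBE_single_inr {F : Type*} [Field F] (α β a1 a2 a2' : F) (t : Fin 2) (a : F)
    (x : (↥(ZS α β) ⊕ Fin 2) →₀ F) :
    brktHom (cBE α β a1 a2 a2') (single (Sum.inr t) a) x = 0 := by
  rw [← brkt_eq_brktHom]
  simp [brkt, cBE_inr_left]

theorem extBracket_skew {F : Type*} [Field F] (α β a1 a2 a2' : F) (p q : ℤ × ℤ) :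
    extBracket α β a1 a2 a2' p q + extBracket α β a1 a2 a2' q p = 0 := by
  have h0 : blockCoeff α β p q + blockCoeff α β q p = 0 := by
    unfold blockCoeff; ring
  have h1 : centralCoeffOne α β a1 p (p + q) + centralCoeffOne α β a1 q (p + q) = 0 := by
    unfold centralCoeffOne
    split_ifs with h
    · obtain ⟨h, h'⟩ := h
      simp only [Prod.fst_add, Prod.snd_add, Int.cast_add] at h h'
      linear_combination a1 * β * h + a1 * α * h'
    · simp
  have h2 : centralCoeffTwo α β a2 a2' p (p + q) + centralCoeffTwo α β a2 a2' q (p + q) = 0 := by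
    unfold centralCoeffTwo
    split_ifs with h
    · obtain ⟨h, h'⟩ := h
      simp only [Prod.fst_add, Prod.snd_add, Int.cast_add] at h h'
      linear_combination (a2 * β + a2') * h + a2 * α * h'
    · simp
  unfold extBracket
  rw [add_comm q p, add_add_add_comm, add_add_add_comm (blockVec α β (p + q) _), ← map_add,
    ← single_add, ← single_add, h0, h1, h2]
  simp

theorem extBracket_jacobi {F : Type*} [Field F] (α β a1 a2 a2' : F) (p q r : ℤ × ℤ) :
    blockCoeff α β q r • extBracket α β a1 a2 a2' p (q + r) +
      blockCoeff α β r p • extBracket α β a1 a2 a2' q (r + p) +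
      blockCoeff α β p q • extBracket α β a1 a2 a2' r (p + q) = 0 := by
  have e1 : q + (r + p) = p + (q + r) := by abel
  have e2 : r + (p + q) = p + (q + r) := by abel
  unfold extBracket
  rw [e1, e2]
  set n := p + (q + r) with hn
  have n1 : (n.1 : F) = p.1 + (q.1 + r.1) := by simp [hn]
  have n2 : (n.2 : F) = p.2 + (q.2 + r.2) := by simp [hn]
  have h0 : blockCoeff α β q r * blockCoeff α β p (q + r) +
      blockCoeff α β r p * blockCoeff α β q (r + p) +
      blockCoeff α β p q * blockCoeff α β r (p + q) = 0 := by
    simp only [blockCoeff, Prod.fst_add, Prod.snd_add, Int.cast_add]; ring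
  have h1 : blockCoeff α β q r * centralCoeffOne α β a1 p n +
      blockCoeff α β r p * centralCoeffOne α β a1 q n +
      blockCoeff α β p q * centralCoeffOne α β a1 r n = 0 := by
    unfold centralCoeffOne
    split_ifs with h
    · obtain ⟨h, h'⟩ := h
      rw [n1] at h
      rw [n2] at h'
      have hr1 : (r.1 : F) = -α - p.1 - q.1 := by linear_combination h
      have hr2 : (r.2 : F) = β - p.2 - q.2 := by linear_combination h'
      simp only [blockCoeff, hr1, hr2]
      ring
    · simp
  have h2 : blockCoeff α β q r * centralCoeffTwo α β a2 a2' p n +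
      blockCoeff α β r p * centralCoeffTwo α β a2 a2' q n +
      blockCoeff α β p q * centralCoeffTwo α β a2 a2' r n = 0 := by
    unfold centralCoeffTwo
    split_ifs with h
    · obtain ⟨h, h'⟩ := h
      rw [n1] at h
      rw [n2] at h'
      have hr1 : (r.1 : F) = -2 * α - p.1 - q.1 := by linear_combination h
      have hr2 : (r.2 : F) = 2 * β - p.2 - q.2 := by linear_combination h'
      simp only [blockCoeff, hr1, hr2]
      ring
    · simp
  have k0 := congrArg (blockVec α β n) h0
  have k1 := congrArg (single (Sum.inr 0 : ↥(ZS α β) ⊕ Fin 2)) h1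
  have k2 := congrArg (single (Sum.inr 1 : ↥(ZS α β) ⊕ Fin 2)) h2
  simp only [map_add, single_add, map_zero, single_zero] at k0 k1 k2
  simp only [← smul_eq_mul, map_smul, ← smul_single] at k0 k1 k2
  simp only [smul_add]
  rw [← add_zero (0 : (↥(ZS α β) ⊕ Fin 2) →₀ F)]
  nth_rewrite 1 [← k0]
  rw [← add_zero (0 : (↥(ZS α β) ⊕ Fin 2) →₀ F)]
  nth_rewrite 1 [← k1]
  rw [← k2]
  abel

/-- The missing vectors `L_{−α,β}` and `L_{−2α,2β}` contribute nothing to double brackets: the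
former would be central, and the latter would not occur in any bracket. -/
theorem blockCoeff_smul_extBracket_of_notMem {F : Type*} [Field F] (α β a1 a2 a2' : F)
    {p q r : ℤ × ℤ} (hp : p ∈ ZS α β) (hqr : q + r ∉ ZS α β) :
    blockCoeff α β q r • extBracket α β a1 a2 a2' p (q + r) = 0 := by
  have hs : (((q + r).1 : F) = -α ∧ ((q + r).2 : F) = β) ∨
      (((q + r).1 : F) = -2 * α ∧ ((q + r).2 : F) = 2 * β) := by
    by_contra hs
    exact hqr (not_or.mp hs)
  rcases hs with ⟨h, h'⟩ | ⟨h, h'⟩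
  · have h0 : blockCoeff α β p (q + r) = 0 := by
      rw [blockCoeff, h, h']
      ring
    have h1 : centralCoeffOne α β a1 p (p + (q + r)) = 0 := by
      unfold centralCoeffOne
      split_ifs with hn
      · rw [Prod.fst_add, Prod.snd_add p, Int.cast_add, Int.cast_add, h, h'] at hn
        linear_combination a1 * β * hn.1 + a1 * α * hn.2
      · rfl
    have h2 : centralCoeffTwo α β a2 a2' p (p + (q + r)) = 0 := by
      unfold centralCoeffTwo
      split_ifs with hn
      · rw [Prod.fst_add, Prod.snd_add p, Int.cast_add, Int.cast_add, h, h'] at hn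
        exact absurd ⟨by linear_combination hn.1, by linear_combination hn.2⟩ hp.1
      · rfl
    simp [extBracket, h0, h1, h2]
  · have h0 : blockCoeff α β q r = 0 := by
      simp only [Prod.fst_add, Prod.snd_add, Int.cast_add] at h h'
      unfold blockCoeff
      linear_combination ((q.1 : F) + α) * h' - ((q.2 : F) - β) * h
    rw [h0, zero_smul]

theorem brktHom_single_extBracket {F : Type*} [Field F] (α β a1 a2 a2' : F) (p : ↥(ZS α β))
    (q r : ℤ × ℤ) :
    brktHom (cBE α β a1 a2 a2') (single (Sum.inl p) 1) (extBracket α β a1 a2 a2' q r) =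
      blockCoeff α β q r • extBracket α β a1 a2 a2' p.1 (q + r) := by
  rw [extBracket, map_add, map_add, brktHom_single, brktHom_single, cBE_inr_right,
    cBE_inr_right, smul_zero, smul_zero, add_zero, add_zero]
  by_cases h : q + r ∈ ZS α β
  · rw [blockVec, dif_pos h, lsingle_apply, brktHom_single, cBE_inl_inl, one_mul]
  · rw [blockCoeff_smul_extBracket_of_notMem α β a1 a2 a2' p.2 h, blockVec, dif_neg h,
      LinearMap.zero_apply, map_zero]

theorem stmt_6 {F : Type*} [Field F] [CharZero F] (α β : F) (hαβ : α * β ≠ 0)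
    (a1 a2 a2' : F) :
    -- the bracket of B(α,β;a₁,a₂,a₂′) is alternating
    (∀ x : (↥(ZS α β) ⊕ Fin 2) →₀ F, brkt (cBE α β a1 a2 a2') x x = 0) ∧
    -- and satisfies the Jacobi identity, so it is a Lie algebra
    (∀ x y z : (↥(ZS α β) ⊕ Fin 2) →₀ F,
      brkt (cBE α β a1 a2 a2') x (brkt (cBE α β a1 a2 a2') y z) +
        brkt (cBE α β a1 a2 a2') y (brkt (cBE α β a1 a2 a2') z x) +
        brkt (cBE α β a1 a2 a2') z (brkt (cBE α β a1 a2 a2') x y) = 0) ∧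
    -- c₁ and c₂ are central
    (∀ t : Fin 2, ∀ x : (↥(ZS α β) ⊕ Fin 2) →₀ F,
      brkt (cBE α β a1 a2 a2') (Finsupp.single (Sum.inr t) (1 : F)) x = 0 ∧
      brkt (cBE α β a1 a2 a2') x (Finsupp.single (Sum.inr t) (1 : F)) = 0) ∧
    -- and modulo `F c₁ ⊕ F c₂` the bracket is that of the Block algebra B(α,β),
    -- i.e. B(α,β;a₁,a₂,a₂′) is a central extension of B(α,β)
    (∀ p q r : ↥(ZS α β),
      brkt (cBE α β a1 a2 a2') (Finsupp.single (Sum.inl p) (1 : F))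
          (Finsupp.single (Sum.inl q) (1 : F)) (Sum.inl r) =
        brkt (cB α β) (Finsupp.single p (1 : F)) (Finsupp.single q (1 : F)) r) := by
  refine ⟨brkt_self_of_skew ?_, brkt_jacobi_of_basis ?_, fun t x => ⟨?_, ?_⟩, fun p q r => ?_⟩
  · rintro (p | s) (q | t)
    · rw [cBE_inl_inl, cBE_inl_inl, extBracket_skew]
    all_goals simp [cBE_inr_left, cBE_inr_right]
  · rintro (p | s) (q | t) (r | u)
    · simp only [cBE_inl_inl, brktHom_single_extBracket, extBracket_jacobi]
    all_goals simp [cBE_inr_left, cBE_inr_right, brktHom_cBE_single_inr]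
  · rw [brkt_eq_brktHom, brktHom_cBE_single_inr]
  · simp [brkt, cBE_inr_right]
  · rw [brkt_eq_brktHom, brkt_eq_brktHom, brktHom_single, brktHom_single]
    by_cases h : p.1 + q.1 ∈ ZS α β
    · simp only [cBE, cB]
      rw [dif_pos h, dif_pos h]
      simp [Finsupp.single_apply]
    · simp only [cBE, cB]
      rw [dif_neg h, dif_neg h]
      simp
end

section
/- For every α ∈ F∖{0}, the bracket [L_{i,j}, L_{k,ℓ}] = a_{i,j,k,ℓ}L_{i+k,j+ℓ} with the structure constants a_{i,j,k,ℓ} given below is alternating and satisfies the Jacobi identity, so C(α) is a ℤ×ℤ-graded Lie algebra over F. -/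
open Finsupp

/-- The coefficients `a_{i,j,k,ℓ}` of `C(α)` in the explicitly listed cases
(all cases with `j ≥ −1`, or with `j ≤ −2` and `ℓ ≤ −2`). -/
noncomputable def aC0 {F : Type*} [Field F] (α : F) (i j k l : ℤ) : F :=
  if -1 ≤ j ∧ -1 ≤ l ∧ -1 ≤ j + l then
    ((k * (j + 1) - (l + 1) * i : ℤ) : F) + ((l - j : ℤ) : F) * α
  else if j = -1 ∧ l = -1 then ((k - i : ℤ) : F)
  else if 0 ≤ j ∧ l ≤ -2 then
    (if 0 ≤ -l - j - 2 then
      (((-l - 2).toNat.factorial / (-l - j - 2).toNat.factorial : ℕ) : F) *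
        (((k * (j + 1) - (l + 1) * i : ℤ) : F) + ((l - j : ℤ) : F) * α)
    else 0)
  else if j = -1 ∧ l ≤ -2 then -α + (i : F)
  else 0

/-- The full family of coefficients `a_{i,j,k,ℓ}` of `C(α)`; in the remaining cases
(`j ≤ −2`, `ℓ ≥ −1`) they are given by anticommutativity: `a_{i,j,k,ℓ} = −a_{k,ℓ,i,j}`. -/
noncomputable def aC {F : Type*} [Field F] (α : F) (i j k l : ℤ) : F :=
  if -1 ≤ j ∨ l ≤ -2 then aC0 α i j k l else -aC0 α k l i j

/-- Structure constants of `C(α)`: `[L_{i,j}, L_{k,ℓ}] = a_{i,j,k,ℓ} L_{i+k, j+ℓ}`. -/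
noncomputable def cC {F : Type*} [Field F] (α : F) (p q : ℤ × ℤ) : (ℤ × ℤ) →₀ F :=
  Finsupp.single (p + q) (aC α p.1 p.2 q.1 q.2)

section Bracket

variable {F : Type*} [Field F] {ι : Type*} (c : ι → ι → (ι →₀ F))

@[simp]
theorem brkt_zero_left (y : ι →₀ F) : brkt c 0 y = 0 := by
  simp [brkt]

@[simp]
theorem brkt_zero_right (x : ι →₀ F) : brkt c x 0 = 0 := by
  simp [brkt]

theorem brkt_add_left (x x' y : ι →₀ F) : brkt c (x + x') y = brkt c x y + brkt c x' y := by
  refine Finsupp.sum_add_index' (fun i => by simp) (fun i a a' => ?_)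
  simp only [add_mul, add_smul, Finsupp.sum_add]

theorem brkt_add_right (x y y' : ι →₀ F) : brkt c x (y + y') = brkt c x y + brkt c x y' := by
  unfold brkt
  rw [← Finsupp.sum_add]
  refine Finsupp.sum_congr fun i _ => ?_
  exact Finsupp.sum_add_index' (fun j => by simp) (fun j b b' => by rw [mul_add, add_smul])

theorem brkt_single_single (i j : ι) (a b : F) :
    brkt c (single i a) (single j b) = (a * b) • c i j := by
  simp [brkt]

variable {c}

theorem brkt_antisymm (hc : ∀ i j, c i j = -c j i) (x y : ι →₀ F) :
    brkt c x y = -brkt c y x := by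
  induction x using Finsupp.induction_linear with
  | zero => simp
  | add x x' hx hx' => rw [brkt_add_left, brkt_add_right, hx, hx', neg_add]
  | single i a =>
    induction y using Finsupp.induction_linear with
    | zero => simp
    | add y y' hy hy' => rw [brkt_add_left, brkt_add_right, hy, hy', neg_add]
    | single j b => rw [brkt_single_single, brkt_single_single, hc i j, smul_neg, mul_comm]

theorem brkt_self [CharZero F] (hc : ∀ i j, c i j = -c j i) (x : ι →₀ F) :
    brkt c x x = 0 :=
  self_eq_neg.mp (brkt_antisymm hc x x)

/-- The Jacobi identity for the bilinear extension follows from the one on basis vectors. -/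
theorem brkt_jacobi
    (hc : ∀ (p q r : ι) (a b d : F),
      brkt c (single p a) (brkt c (single q b) (single r d)) +
        brkt c (single q b) (brkt c (single r d) (single p a)) +
        brkt c (single r d) (brkt c (single p a) (single q b)) = 0)
    (x y z : ι →₀ F) :
    brkt c x (brkt c y z) + brkt c y (brkt c z x) + brkt c z (brkt c x y) = 0 := by
  induction x using Finsupp.induction_linear with
  | zero => simp
  | add x x' hx hx' =>
    simp only [brkt_add_left, brkt_add_right]
    refine Eq.trans ?_ ((congrArg₂ (· + ·) hx hx').trans (add_zero 0))
    abel
  | single p a =>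
    induction y using Finsupp.induction_linear with
    | zero => simp
    | add y y' hy hy' =>
      simp only [brkt_add_left, brkt_add_right]
      refine Eq.trans ?_ ((congrArg₂ (· + ·) hy hy').trans (add_zero 0))
      abel
    | single q b =>
      induction z using Finsupp.induction_linear with
      | zero => simp
      | add z z' hz hz' =>
        simp only [brkt_add_left, brkt_add_right]
        refine Eq.trans ?_ ((congrArg₂ (· + ·) hz hz').trans (add_zero 0))
        abel
      | single r d => exact hc p q r a b d

end Bracket

section StructureConstants

variable {F : Type*} [Field F]

/-- The structure constants of `C(α)` in the rescaled basis in which `L_{i,j}` is divided by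
`(-j-2)!` for `j ≤ -2`; there they are piecewise polynomial. -/
noncomputable def rescaledCoeff (α : F) (i j k l : ℤ) : F :=
  if j = -1 ∧ l = -1 then (k : F) - i
  else if (-1 ≤ j ∧ -1 ≤ l) ∨ ((-1 ≤ j ∨ -1 ≤ l) ∧ j + l ≤ -2) then
    (k - α) * (j + 1) - (l + 1) * (i - α)
  else 0

/-- The scaling factor `(-j-2)!`, which is `1` for `j ≥ -1`. -/
def scale (F : Type*) [Field F] (j : ℤ) : F := ((-j - 2).toNat.factorial : F)

theorem scale_ne_zero [CharZero F] (j : ℤ) : scale F j ≠ 0 :=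
  Nat.cast_ne_zero.mpr (Nat.factorial_ne_zero _)

theorem scale_of_neg_two_le {j : ℤ} (hj : -2 ≤ j) : scale F j = 1 := by
  simp [scale, Int.toNat_of_nonpos (show -j - 2 ≤ 0 by omega)]

theorem scale_neg_one_add {l : ℤ} (hl : l ≤ -2) :
    scale F (-1 + l) = -(l + 1) * scale F l := by
  obtain ⟨n, rfl⟩ : ∃ n : ℕ, l = -n - 2 := ⟨(-l - 2).toNat, by omega⟩
  have h₁ : (-(-1 + (-(n : ℤ) - 2)) - 2).toNat = n + 1 := by omega
  have h₂ : (-(-(n : ℤ) - 2) - 2).toNat = n := by omega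
  rw [scale, scale, h₁, h₂, Nat.factorial_succ]
  push_cast
  ring

theorem rescaledCoeff_antisymm (α : F) (i j k l : ℤ) :
    rescaledCoeff α i j k l = -rescaledCoeff α k l i j := by
  unfold rescaledCoeff
  split_ifs <;> first | omega | ring

set_option maxHeartbeats 1600000 in
theorem rescaledCoeff_jacobi_of_le (α : F) (i k m : ℤ) {j l n : ℤ} (hlj : l ≤ j) (hnl : n ≤ l) :
    rescaledCoeff α k l m n * rescaledCoeff α i j (k + m) (l + n) +
      rescaledCoeff α m n i j * rescaledCoeff α k l (m + i) (n + j) +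
      rescaledCoeff α i j k l * rescaledCoeff α m n (i + k) (j + l) = 0 := by
  unfold rescaledCoeff
  rcases (show j ≤ -2 ∨ j = -1 ∨ j = 0 ∨ 1 ≤ j by omega) with hj | rfl | rfl | hj <;>
  rcases (show l ≤ -2 ∨ l = -1 ∨ l = 0 ∨ 1 ≤ l by omega) with hl | rfl | rfl | hl <;>
  (try omega) <;>
  rcases (show n ≤ -2 ∨ n = -1 ∨ n = 0 ∨ 1 ≤ n by omega) with hn | rfl | rfl | hn <;>
  (try omega) <;>
  repeat' (split <;> try omega)
  all_goals
    first
    | push_cast; ring1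
    | obtain rfl : n = -1 - j := by omega
      push_cast
      ring1

theorem rescaledCoeff_jacobi (α : F) (i j k l m n : ℤ) :
    rescaledCoeff α k l m n * rescaledCoeff α i j (k + m) (l + n) +
      rescaledCoeff α m n i j * rescaledCoeff α k l (m + i) (n + j) +
      rescaledCoeff α i j k l * rescaledCoeff α m n (i + k) (j + l) = 0 := by
  have swap {i j k l m n : ℤ} (h : l ≤ j ∧ n ≤ l ∨ j ≤ l ∧ n ≤ j) :
      rescaledCoeff α k l m n * rescaledCoeff α i j (k + m) (l + n) +
        rescaledCoeff α m n i j * rescaledCoeff α k l (m + i) (n + j) +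
        rescaledCoeff α i j k l * rescaledCoeff α m n (i + k) (j + l) = 0 := by
    obtain ⟨h₁, h₂⟩ | ⟨h₁, h₂⟩ := h
    · exact rescaledCoeff_jacobi_of_le α i k m h₁ h₂
    · have := rescaledCoeff_jacobi_of_le α k i m h₁ h₂
      rw [rescaledCoeff_antisymm α k l m n, rescaledCoeff_antisymm α m n i j,
        rescaledCoeff_antisymm α i j k l, add_comm k m, add_comm l n, add_comm m i,
        add_comm n j, add_comm i k, add_comm j l]
      linear_combination -this
  rcases (show n ≤ l ∧ n ≤ j ∨ l ≤ j ∧ l ≤ n ∨ j ≤ l ∧ j ≤ n by omega) with h | h | h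
  · exact swap (by omega)
  · linear_combination swap (i := m) (j := n) (k := i) (l := j) (m := k) (n := l) (by omega)
  · linear_combination swap (i := k) (j := l) (k := m) (l := n) (m := i) (n := j) (by omega)

theorem aC0_mul_scale [CharZero F] (α : F) {i j k l : ℤ} (h : -1 ≤ j ∨ l ≤ -2) :
    aC0 α i j k l * scale F (j + l) = scale F j * scale F l * rescaledCoeff α i j k l := by
  unfold aC0 rescaledCoeff
  split_ifs <;> try omega
  · rw [scale_of_neg_two_le (by omega), scale_of_neg_two_le (by omega),
      scale_of_neg_two_le (by omega)]
    push_cast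
    ring
  · rw [scale_of_neg_two_le (by omega), scale_of_neg_two_le (by omega),
      scale_of_neg_two_le (by omega)]
    push_cast
    ring
  · have hdvd : (-l - j - 2).toNat.factorial ∣ (-l - 2).toNat.factorial :=
      Nat.factorial_dvd_factorial (by omega)
    have hne : scale F (j + l) ≠ 0 := scale_ne_zero _
    rw [scale_of_neg_two_le (j := j) (by omega), Nat.cast_div hdvd
      (Nat.cast_ne_zero.mpr (Nat.factorial_ne_zero _))]
    rw [show -l - j - 2 = -(j + l) - 2 by ring]
    change scale F l / scale F (j + l) * _ * scale F (j + l) = _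
    field_simp
    push_cast
    ring
  · simp
  · obtain ⟨rfl, hl⟩ := ‹j = -1 ∧ l ≤ -2›
    rw [scale_neg_one_add hl, scale_of_neg_two_le (j := -1) (by omega)]
    push_cast
    ring
  · simp

theorem aC_antisymm (α : F) (i j k l : ℤ) : aC α i j k l = -aC α k l i j := by
  unfold aC aC0
  split_ifs <;> first | omega | (push_cast; ring)

theorem aC_mul_scale [CharZero F] (α : F) (i j k l : ℤ) :
    aC α i j k l * scale F (j + l) = scale F j * scale F l * rescaledCoeff α i j k l := by
  unfold aC
  split_ifs with h
  · exact aC0_mul_scale α h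
  · have := aC0_mul_scale α (i := k) (j := l) (k := i) (l := j) (by omega)
    rw [rescaledCoeff_antisymm, add_comm j l]
    linear_combination -this

theorem aC_jacobi [CharZero F] (α : F) (i j k l m n : ℤ) :
    aC α k l m n * aC α i j (k + m) (l + n) + aC α m n i j * aC α k l (m + i) (n + j) +
      aC α i j k l * aC α m n (i + k) (j + l) = 0 := by
  have key (i j k l m n : ℤ) : aC α k l m n * aC α i j (k + m) (l + n) * scale F (j + (l + n)) =
      scale F j * scale F l * scale F n *
        (rescaledCoeff α k l m n * rescaledCoeff α i j (k + m) (l + n)) := by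
    linear_combination aC α k l m n * aC_mul_scale α i j (k + m) (l + n) +
      scale F j * rescaledCoeff α i j (k + m) (l + n) * aC_mul_scale α k l m n
  have h₁ := key i j k l m n
  have h₂ := key k l m n i j
  have h₃ := key m n i j k l
  rw [show l + (n + j) = j + (l + n) by ring] at h₂
  rw [show n + (j + l) = j + (l + n) by ring] at h₃
  refine (mul_eq_zero.mp ?_).resolve_right (scale_ne_zero (F := F) (j + (l + n)))
  linear_combination h₁ + h₂ + h₃ +
    scale F j * scale F l * scale F n * rescaledCoeff_jacobi α i j k l m n

theorem cC_antisymm (α : F) (p q : ℤ × ℤ) : cC α p q = -cC α q p := by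
  rw [cC, cC, aC_antisymm, add_comm, single_neg]

theorem brkt_cC_single_single (α : F) (p q : ℤ × ℤ) (a b : F) :
    brkt (cC α) (single p a) (single q b) =
      single (p + q) (a * b * aC α p.1 p.2 q.1 q.2) := by
  rw [brkt_single_single, cC, smul_single, smul_eq_mul]

theorem brkt_cC_single_jacobi [CharZero F] (α : F) (p q r : ℤ × ℤ) (a b d : F) :
    brkt (cC α) (single p a) (brkt (cC α) (single q b) (single r d)) +
      brkt (cC α) (single q b) (brkt (cC α) (single r d) (single p a)) +
      brkt (cC α) (single r d) (brkt (cC α) (single p a) (single q b)) = 0 := by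
  simp only [brkt_cC_single_single, Prod.fst_add, Prod.snd_add]
  rw [show q + (r + p) = p + (q + r) by abel, show r + (p + q) = p + (q + r) by abel,
    ← single_add, ← single_add, single_eq_zero]
  linear_combination a * b * d * aC_jacobi α p.1 p.2 q.1 q.2 r.1 r.2

end StructureConstants

theorem stmt_8 {F : Type*} [Field F] [CharZero F] (α : F) (hα : α ≠ 0) :
    -- the bracket of C(α) is alternating
    (∀ x : (ℤ × ℤ) →₀ F, brkt (cC α) x x = 0) ∧
    -- and satisfies the Jacobi identity
    (∀ x y z : (ℤ × ℤ) →₀ F,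
      brkt (cC α) x (brkt (cC α) y z) + brkt (cC α) y (brkt (cC α) z x) +
        brkt (cC α) z (brkt (cC α) x y) = 0) ∧
    -- hence C(α) is a ℤ×ℤ-graded Lie algebra: the bracket of basis vectors of
    -- degrees p and q is concentrated in degree p + q
    (∀ p q r : ℤ × ℤ, r ≠ p + q →
      brkt (cC α) (Finsupp.single p (1 : F)) (Finsupp.single q (1 : F)) r = 0) := by
  refine ⟨brkt_self (cC_antisymm α), brkt_jacobi (brkt_cC_single_jacobi α), fun p q r hr => ?_⟩
  rw [brkt_cC_single_single, single_eq_of_ne hr]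
end
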